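/- In every trace of the p-player Hanabi bookkeeping model, the number of play turns t (plays, successful or not, including firework-completing plays) satisfying Σ_{t+1} = Σ_t is at most 5 + p. -/

import Mathlib

/-- A state of the Hanabi bookkeeping model:
`m` hint tokens, `d` cards left in the deck, `q` remaining turns once the
deck is empty, `f` completed fireworks, `s` score. -/
structure HState where
  m : ℕ
  d : ℕ
  q : ℕ
  f : ℕ
  s : ℕ

/-- The invariants a state must satisfy. -/
def HState.valid (st : HState) : Prop :=
  st.m ≤ 8 ∧ st.f ≤ 5 ∧ 5 * st.f ≤ st.s ∧ st.s ≤ 20 + st.f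

/-- The possible kinds of turns. -/
inductive HAction where
  | hint | discard | playFail | playSucc | playComplete
deriving DecidableEq

/-- Is the action a play (successful or not, possibly firework-completing)? -/
def HAction.isPlay : HAction → Prop
  | .hint => False
  | .discard => False
  | _ => True

instance : DecidablePred HAction.isPlay := by
  intro a; cases a <;> simp [HAction.isPlay] <;> infer_instance

/-- A turn of kind `a` from state `st` to state `st'`. -/
def Step (a : HAction) (st st' : HState) : Prop :=
  st.valid ∧ st'.valid ∧
  -- a turn is allowed only if the score is below 25 and the game is not over
  st.s < 25 ∧ (1 ≤ st.d ∨ 1 ≤ st.q) ∧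
  -- update of the deck size and of the remaining-turns counter
  st'.d = (if 1 ≤ st.d ∧ a ≠ .hint then st.d - 1 else st.d) ∧
  st'.q = (if st.d = 0 then st.q - 1 else st.q) ∧
  -- effect of the individual actions
  (match a with
  | .hint => 1 ≤ st.m ∧ st'.m = st.m - 1 ∧ st'.f = st.f ∧ st'.s = st.s
  | .discard => st.m ≤ 7 ∧ st'.m = st.m + 1 ∧ st'.f = st.f ∧ st'.s = st.s
  | .playFail => st'.m = st.m ∧ st'.f = st.f ∧ st'.s = st.s
  | .playSucc => st'.m = st.m ∧ st'.f = st.f ∧ st'.s = st.s + 1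
  | .playComplete =>
      st.f ≤ 4 ∧ st'.m = min (st.m + 1) 8 ∧ st'.f = st.f + 1 ∧ st'.s = st.s + 1)

/-- Hand size for `p` players. -/
def handSize (p : ℕ) : ℕ := if p ≤ 3 then 5 else 4

/-- Initial deck size for `p` players. -/
def initialDeck (p : ℕ) : ℕ := 50 - p * handSize p

/-- The initial state for `p` players. -/
def initState (p : ℕ) : HState := ⟨8, initialDeck p, p, 0, 0⟩

/-- A trace of length `n` (i.e. with `n` turns) of the `p`-player Hanabi
bookkeeping model: `n + 1` states starting at the initial state, with
consecutive states related by turns. -/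
structure Trace (p n : ℕ) where
  state : Fin (n + 1) → HState
  action : Fin n → HAction
  init : state 0 = initState p
  step : ∀ t : Fin n, Step (action t) (state t.castSucc) (state t.succ)

/-- `c_t`: hint tokens still usable before the deck is empty. -/
def cVal (st : HState) : ℕ := if 1 ≤ st.d then st.m else 0

/-- `u_t`: the undisclosed hints. -/
def uVal (st : HState) : ℕ := if 1 ≤ st.d then st.d - 1 else 0

/-- `Σ_t = t + c_t + d_t + u_t + q_t` along a trace. -/
def sigma {p n : ℕ} (tr : Trace p n) (i : Fin (n + 1)) : ℕ :=
  (i : ℕ) + cVal (tr.state i) + (tr.state i).d + uVal (tr.state i)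
    + (tr.state i).q

/-- The trace obtained by forgetting the last turn. -/
def Trace.dropLast {p n : ℕ} (tr : Trace p (n + 1)) : Trace p n where
  state i := tr.state i.castSucc
  action i := tr.action i.castSucc
  init := tr.init
  step i := tr.step i.castSucc

/-- The number of play turns of a trace that leave `sigma` unchanged. -/
def Trace.exceptionCount {p n : ℕ} (tr : Trace p n) : ℕ :=
  (Finset.univ.filter fun t : Fin n =>
    (tr.action t).isPlay ∧ sigma tr t.succ = sigma tr t.castSucc).card

theorem Trace.exceptionCount_succ {p n : ℕ} (tr : Trace p (n + 1)) :
    tr.exceptionCount = tr.dropLast.exceptionCount +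
      if (tr.action (Fin.last n)).isPlay ∧
        sigma tr (Fin.last n).succ = sigma tr (Fin.last n).castSucc then 1 else 0 := by
  unfold Trace.exceptionCount
  rw [Finset.card_filter, Finset.card_filter, Fin.sum_univ_castSucc]
  rfl

/-- While the deck is nonempty, the turns counted so far complete distinct fireworks; once it is
empty, each of them uses up one of the remaining turns. -/
def ExceptionBound (p c : ℕ) (st : HState) : Prop :=
  (1 ≤ st.d → st.q = p ∧ c ≤ st.f) ∧ (st.d = 0 → c + st.q ≤ 5 + p)

theorem ExceptionBound.step {p c k : ℕ} {a : HAction} {st st' : HState}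
    (h : ExceptionBound p c st) (hs : Step a st st') :
    ExceptionBound p
      (c + if a.isPlay ∧ k + 1 + cVal st' + st'.d + uVal st' + st'.q =
        k + cVal st + st.d + uVal st + st.q then 1 else 0) st' := by
  obtain ⟨m, d, q, f, s⟩ := st
  obtain ⟨m', d', q', f', s'⟩ := st'
  cases a <;>
    simp only [ExceptionBound, Step, HState.valid, HAction.isPlay, cVal, uVal, ne_eq,
      reduceCtorEq, not_true_eq_false, not_false_eq_true, and_true, and_false, true_and,
      false_and, if_false, add_zero] at * <;>
    grind

theorem Trace.exceptionBound {p : ℕ} (hp : p ≤ 5) {n : ℕ} (tr : Trace p n) :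
    ExceptionBound p tr.exceptionCount (tr.state (Fin.last n)) := by
  induction n with
  | zero =>
    have hd : 1 ≤ initialDeck p := by interval_cases p <;> decide
    have hc : tr.exceptionCount = 0 := rfl
    have hi : tr.state (Fin.last 0) = initState p := tr.init
    rw [hc, hi]
    exact ⟨fun _ => ⟨rfl, le_rfl⟩, fun h => absurd h (Nat.ne_of_gt hd)⟩
  | succ n ih =>
    rw [Trace.exceptionCount_succ]
    exact (ih tr.dropLast).step (tr.step (Fin.last n))

/-- In every trace of the `p`-player Hanabi bookkeeping model, the number of
play turns `t` satisfying `Σ_{t+1} = Σ_t` is at most `5 + p`. -/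
theorem hanabi_exception_plays_le (p : ℕ) (hp₂ : 2 ≤ p) (hp₅ : p ≤ 5)
    (n : ℕ) (tr : Trace p n) :
    (Finset.univ.filter fun t : Fin n =>
        (tr.action t).isPlay ∧ sigma tr t.succ = sigma tr t.castSucc).card
      ≤ 5 + p := by
  change tr.exceptionCount ≤ 5 + p
  obtain ⟨hpos, hzero⟩ := tr.exceptionBound hp₅
  have hf : (tr.state (Fin.last n)).f ≤ 5 := by
    cases n with
    | zero =>
      have hi : tr.state (Fin.last 0) = initState p := tr.init
      rw [hi]
      exact Nat.zero_le 5
    | succ n => exact (tr.step (Fin.last n)).2.1.2.1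
  omega
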